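/- Let n be a positive integer and let w∈B_n be fully commutative. Then every decreasing subsequence of length 3 in w^0 is contained in a subsequence of pattern [2,−1,1,−2] whose last two letters lie in the right half: whenever positions p_1<p_2<p_3 satisfy w^0_{p_1}>w^0_{p_2}>w^0_{p_3}, there exist integers A>B>0 and positions q_1<q_2<q_3<q_4 in {1,…,2n} with {p_1,p_2,p_3}⊆{q_1,q_2,q_3,q_4}, q_3>n, q_4>n, and (w^0_{q_1},w^0_{q_2},w^0_{q_3},w^0_{q_4})=(A,−B,B,−A). -/

import Mathlib

open scoped Classical

noncomputable section

namespace Paper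

/-- Membership in the hyperoctahedral group `B_n`, realized inside `Equiv.Perm ℤ`:
`w(-i) = -w(i)` and `w` fixes every integer of absolute value larger than `n`. -/
def InB (n : ℕ) (w : Equiv.Perm ℤ) : Prop :=
  (∀ i : ℤ, w (-i) = - w i) ∧ ∀ i : ℤ, (n : ℤ) < |i| → w i = i

/-- Window entry `w_i` with the convention `w_0 = 0`. -/
def went (w : Equiv.Perm ℤ) (i : ℕ) : ℤ := if i = 0 then 0 else w (i : ℤ)

/-- Stembridge's pattern criterion: `w ∈ B_n` is fully commutative iff there are no
indices `i<j` with `0 > w_i > w_j`, no `i<j<k` with `|w_i| > w_j > w_k`, and no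
`i<j<k` with `-w_j > |w_i| > w_k`. -/
def IsFC (n : ℕ) (w : Equiv.Perm ℤ) : Prop :=
  InB n w ∧
  (¬ ∃ i j : ℕ, 1 ≤ i ∧ i < j ∧ j ≤ n ∧ w (j : ℤ) < w (i : ℤ) ∧ w (i : ℤ) < 0) ∧
  (¬ ∃ i j k : ℕ, 1 ≤ i ∧ i < j ∧ j < k ∧ k ≤ n ∧
      w (j : ℤ) < |w (i : ℤ)| ∧ w (k : ℤ) < w (j : ℤ)) ∧
  (¬ ∃ i j k : ℕ, 1 ≤ i ∧ i < j ∧ j < k ∧ k ≤ n ∧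
      |w (i : ℤ)| < - w (j : ℤ) ∧ w (k : ℤ) < |w (i : ℤ)|)

/-- Membership in `S_n ⊆ B_n`: all window entries positive. -/
def InS (n : ℕ) (w : Equiv.Perm ℤ) : Prop :=
  InB n w ∧ ∀ i : ℕ, 1 ≤ i → i ≤ n → 0 < w (i : ℤ)

/-- 321-avoidance of the window. -/
def Avoids321 (n : ℕ) (w : Equiv.Perm ℤ) : Prop :=
  ¬ ∃ i j k : ℕ, 1 ≤ i ∧ i < j ∧ j < k ∧ k ≤ n ∧
    w (k : ℤ) < w (j : ℤ) ∧ w (j : ℤ) < w (i : ℤ)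

/-- Type-B descent set `Des_B(w) = {0 ≤ i ≤ n-1 : w_i > w_{i+1}}`, convention `w_0 = 0`. -/
def DesB (n : ℕ) (w : Equiv.Perm ℤ) : Finset ℕ :=
  (Finset.range n).filter fun i => went w (i+1) < went w i

/-- Type-A descent set `Des(w) = {1 ≤ i ≤ n-1 : w_i > w_{i+1}}`. -/
def DesA (n : ℕ) (w : Equiv.Perm ℤ) : Finset ℕ :=
  (Finset.Ico 1 n).filter fun i => went w (i+1) < went w i

/-- Last descent: `ldes(w) = max (Des_B(w) ∪ {0})`. -/
def ldes (n : ℕ) (w : Equiv.Perm ℤ) : ℕ := (DesB n w).sup id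

/-- `Neg(w) = {1 ≤ i ≤ n : w_i < 0}`. -/
def NegSet (n : ℕ) (w : Equiv.Perm ℤ) : Finset ℕ :=
  (Finset.Icc 1 n).filter fun i => w (i : ℤ) < 0

/-- Block number `bl(w) = 1 + #{1 ≤ i ≤ n-1 : max(w_1,…,w_i) < min(w_{i+1},…,w_n)}`. -/
def bl (n : ℕ) (w : Equiv.Perm ℤ) : ℕ :=
  1 + ((Finset.Ioo 0 n).filter fun i : ℕ =>
    ∀ j ∈ Finset.Icc 1 i, ∀ k ∈ Finset.Icc (i + 1) n, w ((j : ℕ) : ℤ) < w ((k : ℕ) : ℤ)).card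

/-- Chow's type-B fundamental quasi-symmetric function `F^B_J` in variables `x_0,x_1,…`:
the sum of `x_{i_1} ⋯ x_{i_n}` over `0 ≤ i_1 ≤ ⋯ ≤ i_n` with `i_j < i_{j+1}` for `j ∈ J`,
with the convention `i_0 = 0`. A sequence is encoded by `f : ℕ → ℕ` with `f a = i_a`
for `1 ≤ a ≤ n`, normalized by `f 0 = 0` and `f a = 0` for `a > n`. -/
def FB (R : Type) [CommRing R] (n : ℕ) (J : Finset ℕ) : MvPowerSeries ℕ R :=
  fun m => (Nat.card {f : ℕ → ℕ //
    f 0 = 0 ∧ (∀ a, n < a → f a = 0) ∧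
    (∀ a b, a ≤ b → b ≤ n → f a ≤ f b) ∧
    (∀ j ∈ J, f j < f (j + 1)) ∧
    ∀ v : ℕ, m v = ((Finset.Icc 1 n).filter fun a => f a = v).card} : R)

/-- Gessel's fundamental quasi-symmetric function `F_J` in variables `x_1,x_2,…`. -/
def FA (R : Type) [CommRing R] (n : ℕ) (J : Finset ℕ) : MvPowerSeries ℕ R :=
  fun m => (Nat.card {f : ℕ → ℕ //
    f 0 = 0 ∧ (∀ a, n < a → f a = 0) ∧
    (∀ a, 1 ≤ a → a ≤ n → 1 ≤ f a) ∧
    (∀ a b, 1 ≤ a → a ≤ b → b ≤ n → f a ≤ f b) ∧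
    (∀ j ∈ J, f j < f (j + 1)) ∧
    ∀ v : ℕ, m v = ((Finset.Icc 1 n).filter fun a => f a = v).card} : R)

/-- Complete homogeneous symmetric function `h_m` in the variables `x_s, x_{s+1}, …`. -/
def hSeries (R : Type) [CommRing R] (s m : ℕ) : MvPowerSeries ℕ R :=
  fun μ => if (μ.sum fun _ v => v) = m ∧ ∀ a < s, μ a = 0 then 1 else 0

/-- Number of semistandard Young tableaux of shape `lam` (row lengths `lam 0 ≥ lam 1 ≥ …`),
with all entries `≥ s`, rows weakly increasing, columns strictly increasing,
and content `μ` (the value `v` occurs `μ v` times). Tableaux are normalized to be `0`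
outside the cells of the diagram. -/
def schurCoeff (s : ℕ) (lam : ℕ → ℕ) (μ : ℕ → ℕ) : ℕ :=
  Nat.card {T : ℕ → ℕ → ℕ //
    (∀ i j, j + 1 < lam i → T i j ≤ T i (j + 1)) ∧
    (∀ i j, j < lam (i + 1) → T i j < T (i + 1) j) ∧
    (∀ i j, j < lam i → s ≤ T i j) ∧
    (∀ i j, ¬ j < lam i → T i j = 0) ∧
    ∀ v : ℕ, μ v = Nat.card {p : ℕ × ℕ // p.2 < lam p.1 ∧ T p.1 p.2 = v}}

/-- The Schur function `s_lam` in the variables `x_s, x_{s+1}, …`. -/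
def schurS (R : Type) [CommRing R] (s : ℕ) (lam : ℕ → ℕ) : MvPowerSeries ℕ R :=
  fun m => (schurCoeff s lam (fun v => m v) : R)

/-- The two-row shape `(a, b)` as a row-length function. -/
def twoRow (a b : ℕ) : ℕ → ℕ := fun i => if i = 0 then a else if i = 1 then b else 0

/-- Row-length function of a partition of `k`. -/
def partFun {k : ℕ} (p : Nat.Partition k) : ℕ → ℕ :=
  fun i => ((p.parts.sort (· ≤ ·)).reverse).getD i 0

/-- Conjugate of a row-length function. -/
def conjFun (lam : ℕ → ℕ) : ℕ → ℕ := fun j => Nat.card {i : ℕ // j < lam i}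

/-- Descent set of the standard Young tableau of skew shape `(n,k)/(k)` (resp. of the
bi-tableau of bi-shape `((k),(n-k))`) encoded by the set `S ⊆ {1,…,n}` of entries of the
length-`k` bottom row: `{1 ≤ i ≤ n-1 : i ∉ S, i+1 ∈ S}`. -/
def DesSet (n : ℕ) (S : Finset ℕ) : Finset ℕ :=
  (Finset.Ico 1 n).filter fun i => i ∉ S ∧ i + 1 ∈ S

/-- Last descent of the tableau encoded by `S`. -/
def ldesSet (n : ℕ) (S : Finset ℕ) : ℕ := (DesSet n S).sup id

/-- Type-B descent set of the bi-tableau encoded by `S`: add `0` when `1 ∈ S`. -/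
def DesBSet (n : ℕ) (S : Finset ℕ) : Finset ℕ :=
  if 1 ∈ S then insert 0 (DesSet n S) else DesSet n S

/-- `b_{n,k,j}`: the number of standard Young tableaux of skew shape `(n,k)/(k)`
(encoded by `k`-subsets `S ⊆ {1,…,n}`) with `ldes = n - j`. -/
def bCoeff (n k j : ℕ) : ℕ :=
  ((Finset.Icc 1 n).powerset.filter fun S => S.card = k ∧ ldesSet n S = n - j).card

/-- `a_{n,k,j}`: the number of standard Young tableaux of shape `(n-k,k)` (encoded by
`k`-subsets `S ⊆ {1,…,n}` of second-row entries satisfying the ballot condition)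
with `ldes = n - j`. -/
def aCoeff (n k j : ℕ) : ℕ :=
  ((Finset.Icc 1 n).powerset.filter fun S => S.card = k ∧
    (∀ i ∈ Finset.Icc 1 n, 2 * (S.filter (· ≤ i)).card ≤ i) ∧ ldesSet n S = n - j).card

/-- `e_{n,m,J}`: number of `m`-subsets `S ⊆ {1,…,n}` with `Des_B(S) = J`. -/
def eCoeff (n m : ℕ) (J : Finset ℕ) : ℕ :=
  ((Finset.Icc 1 n).powerset.filter fun S => S.card = m ∧ DesBSet n S = J).card

/-- `d_{n,m,j}`: number of `m`-subsets `S ⊆ {1,…,n}` with `ldes(S) = n - j`. -/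
def dCoeff (n m j : ℕ) : ℕ :=
  ((Finset.Icc 1 n).powerset.filter fun S => S.card = m ∧ ldesSet n S = n - j).card

/-- The palindromic representation `w^0 = [-w_n, …, -w_1, w_1, …, w_n]`,
as a function of the position `p ∈ {1,…,2n}`. -/
def wzero (n : ℕ) (w : Equiv.Perm ℤ) : ℕ → ℤ :=
  fun p => if p ≤ n then - w ((n : ℤ) + 1 - (p : ℤ)) else w ((p : ℤ) - (n : ℤ))

/-- Greene invariant: the maximal total size of a union of `j` increasing subsequences
of `w^0` (a set of positions is such a union iff it admits a coloring by `j` colors with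
each color class increasing). By Greene's theorem this equals `λ_1 + ⋯ + λ_j` for the
RSK shape `λ(w^0)`. -/
def greene (n : ℕ) (w : Equiv.Perm ℤ) (j : ℕ) : ℕ :=
  ((Finset.Icc 1 (2 * n)).powerset.filter fun P =>
    ∃ c : ℕ → Fin j, ∀ p ∈ P, ∀ q ∈ P, p < q → c p = c q →
      wzero n w p < wzero n w q).sup Finset.card

/-- First valley `v(π)`. -/
def firstValley (n : ℕ) (π : Equiv.Perm ℤ) : ℕ :=
  if h : ((DesA n π⁻¹).erase 1).Nonempty then ((DesA n π⁻¹).erase 1).min' h else n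

/-- Order key for the order `-1 <r -2 <r ⋯ <r -n <r 1 <r ⋯ <r n`. -/
def rkey (n : ℕ) (a : ℤ) : ℤ := if a < 0 then -a else a + n

/-- The r-descent set `rDes(w) = {1 ≤ i ≤ n-1 : w_i >r w_{i+1}}`. -/
def rDes (n : ℕ) (w : Equiv.Perm ℤ) : Finset ℕ :=
  (Finset.Ico 1 n).filter fun i : ℕ =>
    rkey n (w (((i : ℕ) + 1 : ℕ) : ℤ)) < rkey n (w ((i : ℕ) : ℤ))

/-- Poirier's type-B quasi-symmetric function `F^P_w(X,Y)`, a power series in the two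
alphabets `x_1,x_2,…` (indexed by `Sum.inl`) and `y_1,y_2,…` (indexed by `Sum.inr`). -/
def FP (n : ℕ) (w : Equiv.Perm ℤ) : MvPowerSeries (ℕ ⊕ ℕ) ℤ :=
  fun m => (Nat.card {f : ℕ → ℕ //
    f 0 = 0 ∧ (∀ a, n < a → f a = 0) ∧
    (∀ a, 1 ≤ a → a ≤ n → 1 ≤ f a) ∧
    (∀ a b, 1 ≤ a → a ≤ b → b ≤ n → f a ≤ f b) ∧
    (∀ j ∈ rDes n w, f j < f (j + 1)) ∧
    (∀ v : ℕ, m (Sum.inl v) =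
      ((Finset.Icc 1 n).filter fun a => f a = v ∧ 0 < w ((a : ℕ) : ℤ)).card) ∧
    ∀ v : ℕ, m (Sum.inr v) =
      ((Finset.Icc 1 n).filter fun a => f a = v ∧ w ((a : ℕ) : ℤ) < 0).card} : ℤ)

/-- The Schur function `s_lam(X)` in the first alphabet `x_1,x_2,…`. -/
def schurX (lam : ℕ → ℕ) : MvPowerSeries (ℕ ⊕ ℕ) ℤ :=
  fun m => if ∀ v, m (Sum.inr v) = 0 then
    (schurCoeff 1 lam fun v => m (Sum.inl v) : ℤ) else 0

/-- The Schur function `s_lam(Y)` in the second alphabet `y_1,y_2,…`. -/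
def schurY (lam : ℕ → ℕ) : MvPowerSeries (ℕ ⊕ ℕ) ℤ :=
  fun m => if ∀ v, m (Sum.inl v) = 0 then
    (schurCoeff 1 lam fun v => m (Sum.inr v) : ℤ) else 0

/-- Chow type-B Schur-positivity: a nonnegative combination of the products
`s_{λ⁻}(x_1,x_2,…) ⋅ s_{λ⁺}(x_0,x_1,…)` over pairs of partitions of total size `n`. -/
def ChowPos (n : ℕ) (F : MvPowerSeries ℕ ℤ) : Prop :=
  ∃ c : (Σ k : Fin (n + 1), Nat.Partition (k : ℕ) × Nat.Partition (n - (k : ℕ))) → ℕ,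
    F = ∑ p : (Σ k : Fin (n + 1), Nat.Partition (k : ℕ) × Nat.Partition (n - (k : ℕ))),
      (c p : ℤ) • (schurS ℤ 1 (partFun p.2.1) * schurS ℤ 0 (partFun p.2.2))

theorem IsFC.pos_of_descent {n : ℕ} {w : Equiv.Perm ℤ} (hw : IsFC n w) {j k : ℕ}
    (hj : 1 ≤ j) (hjk : j < k) (hk : k ≤ n) (hd : w (k : ℤ) < w (j : ℤ)) :
    0 < w (j : ℤ) := by
  obtain ⟨⟨hodd, -⟩, hneg, -, -⟩ := hw
  have h0 : w 0 = 0 := by have := hodd 0; simp only [neg_zero] at this; lia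
  have hne : w (j : ℤ) ≠ 0 := fun h => by
    have := w.injective (h.trans h0.symm)
    lia
  by_contra hle
  exact hneg ⟨j, k, hj, hjk, hk, hd, by lia⟩

/-- The window of a fully commutative signed permutation has no decreasing triple. -/
theorem IsFC.avoids321 {n : ℕ} {w : Equiv.Perm ℤ} (hw : IsFC n w) : Avoids321 n w := by
  rintro ⟨i, j, k, hi, hij, hjk, hk, hkj, hji⟩
  exact hw.2.2.1 ⟨i, j, k, hi, hij, hjk, hk, hji.trans_le (le_abs_self _), hkj⟩

/-- If `-w_i > w_j > w_k` with `j < k`, then `i = k`. -/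
theorem IsFC.eq_of_lt_neg {n : ℕ} {w : Equiv.Perm ℤ} (hw : IsFC n w) {i j k : ℕ}
    (hi : 1 ≤ i) (hin : i ≤ n) (hj : 1 ≤ j) (hjk : j < k) (hk : k ≤ n)
    (hij : w (j : ℤ) < -w (i : ℤ)) (hd : w (k : ℤ) < w (j : ℤ)) : i = k := by
  have hpos := hw.pos_of_descent hj hjk hk hd
  obtain ⟨-, -, habs, hnabs⟩ := hw
  have hjabs : |w (j : ℤ)| = w (j : ℤ) := abs_of_pos hpos
  rcases lt_trichotomy i j with h | rfl | h
  · exact (habs ⟨i, j, k, hi, h, hjk, hk, hij.trans_le (neg_le_abs _), hd⟩).elim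
  · lia
  rcases lt_trichotomy i k with h' | h' | h'
  · exact (hnabs ⟨j, i, k, hj, h, h', hk, by lia, by lia⟩).elim
  · exact h'
  · rcases lt_or_ge (w (i : ℤ)) (w (k : ℤ)) with h'' | h''
    · exact (habs ⟨j, k, i, hj, hjk, h', hin, by lia, h''⟩).elim
    · exact (hnabs ⟨j, k, i, hj, hjk, h', hin, by lia, by lia⟩).elim

theorem wzero_left {n : ℕ} {w : Equiv.Perm ℤ} {i : ℕ} (hi : 1 ≤ i) (hin : i ≤ n) :
    wzero n w (n + 1 - i) = -w (i : ℤ) := by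
  have h : ((n : ℤ) + 1 - ((n + 1 - i : ℕ) : ℤ)) = i := by lia
  rw [wzero, if_pos (by lia), h]

theorem wzero_right {n : ℕ} {w : Equiv.Perm ℤ} {i : ℕ} (hi : 1 ≤ i) :
    wzero n w (n + i) = w (i : ℤ) := by
  have h : ((n + i : ℕ) : ℤ) - n = i := by lia
  rw [wzero, if_neg (by lia), h]

/-- Every position of `w^0` is that of some `-w_i` or some `w_i`. -/
theorem exists_position_eq {n p : ℕ} (hp : 1 ≤ p) (hpn : p ≤ 2 * n) :
    ∃ i, 1 ≤ i ∧ i ≤ n ∧ (p = n + 1 - i ∨ p = n + i) := by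
  rcases le_or_gt p n with h | h
  · exact ⟨n + 1 - p, by lia, by lia, by lia⟩
  · exact ⟨p - n, by lia, by lia, by lia⟩

/-- A descent `w_j > w_k` with `w_j < -w_k` gives the pattern `[2, -1, 1, -2]` in `w^0`. -/
theorem exists_pattern_of_descent {n : ℕ} {w : Equiv.Perm ℤ} {j k : ℕ}
    (hj : 1 ≤ j) (hjk : j < k) (hk : k ≤ n) (hpos : 0 < w (j : ℤ))
    (hlt : w (j : ℤ) < -w (k : ℤ)) {s : Finset ℕ}
    (hs : s ⊆ {n + 1 - k, n + 1 - j, n + j, n + k}) :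
    ∃ A B : ℤ, ∃ q₁ q₂ q₃ q₄ : ℕ,
      0 < B ∧ B < A ∧
      1 ≤ q₁ ∧ q₁ < q₂ ∧ q₂ < q₃ ∧ q₃ < q₄ ∧ q₄ ≤ 2 * n ∧ n < q₃ ∧ n < q₄ ∧
      s ⊆ {q₁, q₂, q₃, q₄} ∧
      wzero n w q₁ = A ∧ wzero n w q₂ = -B ∧ wzero n w q₃ = B ∧ wzero n w q₄ = -A :=
  ⟨-w (k : ℤ), w (j : ℤ), n + 1 - k, n + 1 - j, n + j, n + k, hpos, hlt,
    by lia, by lia, by lia, by lia, by lia, by lia, by lia, hs,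
    wzero_left (by lia) hk, wzero_left hj (by lia), wzero_right hj,
    by rw [wzero_right (by lia), neg_neg]⟩

theorem decreasing_three_in_pattern (n : ℕ) (hn : 0 < n) (w : Equiv.Perm ℤ)
    (hw : IsFC n w) (p₁ p₂ p₃ : ℕ) (h1 : 1 ≤ p₁) (h12 : p₁ < p₂) (h23 : p₂ < p₃)
    (h3 : p₃ ≤ 2 * n) (hd1 : wzero n w p₂ < wzero n w p₁)
    (hd2 : wzero n w p₃ < wzero n w p₂) :
    ∃ A B : ℤ, ∃ q₁ q₂ q₃ q₄ : ℕ,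
      0 < B ∧ B < A ∧
      1 ≤ q₁ ∧ q₁ < q₂ ∧ q₂ < q₃ ∧ q₃ < q₄ ∧ q₄ ≤ 2 * n ∧ n < q₃ ∧ n < q₄ ∧
      ({p₁, p₂, p₃} : Finset ℕ) ⊆ {q₁, q₂, q₃, q₄} ∧
      wzero n w q₁ = A ∧ wzero n w q₂ = -B ∧ wzero n w q₃ = B ∧ wzero n w q₄ = -A := by
  obtain ⟨a, ha, han, rfl | rfl⟩ := exists_position_eq (n := n) h1 (by lia) <;>
  obtain ⟨b, hb, hbn, rfl | rfl⟩ := exists_position_eq (n := n) (p := p₂) (by lia) (by lia) <;>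
  obtain ⟨c, hc, hcn, rfl | rfl⟩ := exists_position_eq (n := n) (p := p₃) (by lia) h3 <;>
  first | lia | simp only [wzero_left, wzero_right, ha, hb, hc, han, hbn, hcn] at hd1 hd2
  · exact (hw.avoids321 ⟨c, b, a, hc, by lia, by lia, han, by lia, by lia⟩).elim
  · obtain rfl := hw.eq_of_lt_neg hc hcn hb (by lia) han (by lia) (by lia)
    exact exists_pattern_of_descent hb (by lia) hcn
      (hw.pos_of_descent hb (k := c) (by lia) hcn (by lia)) (by lia) (by grind)
  · obtain rfl := hw.eq_of_lt_neg ha han hb (by lia) hcn (by lia) (by lia)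
    exact exists_pattern_of_descent hb (by lia) han
      (hw.pos_of_descent hb (k := a) (by lia) han (by lia)) (by lia) (by grind)
  · exact (hw.avoids321 ⟨a, b, c, ha, by lia, by lia, hcn, by lia, by lia⟩).elim

end Paper
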